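/- Let q be a prime power, n ≥ 4 a natural number, m a positive divisor of q^n − 1, and β a 2-normal element of F_{q^n} over F_q such that β ∉ F_{q^d} for every proper divisor d < n of n. Let N_β(m) be the number of elements a ∈ F_q such that a + β is m-free. If q^{1/2} ≥ (n − 1) · W(m), then N_β(m) > 0; in particular there exists a ∈ F_q such that a + β is m-free. -/

import Mathlib

open Polynomial

noncomputable section

/-- An element of a finite field is *primitive* if it generates the cyclic multiplicative
group, i.e. its multiplicative order is `card E - 1`. -/
def IsPrimitiveElem {E : Type*} [Field E] [Fintype E] (α : E) : Prop :=
  orderOf α = Fintype.card E - 1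

/-- The polynomial `g_α(x) = Σ_{i=0}^{n-1} α^{q^i} x^{n-1-i} ∈ F_{q^n}[x]`. -/
def gPoly {E : Type*} [Field E] (q n : ℕ) (α : E) : Polynomial E :=
  ∑ i ∈ Finset.range n, C (α ^ q ^ i) * X ^ (n - 1 - i)

/-- `α ∈ F_{q^n}` is `k`-normal over `F_q` if `gcd(x^n - 1, g_α(x))` in `F_{q^n}[x]`
has degree `k`. -/
def IsKNormal {E : Type*} [Field E] (q n k : ℕ) (α : E) : Prop :=
  (@EuclideanDomain.gcd (Polynomial E) _ (Classical.decEq _)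
    ((X : Polynomial E) ^ n - 1) (gPoly q n α)).natDegree = k

/-- For `m ∣ q^n - 1`, an element `γ ∈ F_{q^n}*` is `m`-free if whenever `γ = δ^d` for
some `δ ∈ F_{q^n}` and some divisor `d` of `m`, then `d = 1`. -/
def IsFree {E : Type*} [Field E] (m : ℕ) (γ : E) : Prop :=
  γ ≠ 0 ∧ ∀ d : ℕ, d ∣ m → (∃ δ : E, γ = δ ^ d) → d = 1

/-- `Wnat m` is the number of squarefree divisors of the integer `m`. -/
def Wnat (m : ℕ) : ℕ := Nat.card {d : ℕ // d ∣ m ∧ Squarefree d}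

theorem norm_le_one_of_bounded_power_sums {ι : Type*} [Fintype ι] (z : ι → ℂ) (B : ℝ)
    (h : ∀ s : ℕ, 1 ≤ s → ‖∑ i, z i ^ s‖ ≤ B) (i₀ : ι) : ‖z i₀‖ ≤ 1 := by
  classical
  by_contra! hlt
  set T : Finset ℂ := (Finset.univ.image z).erase (z i₀) with hT
  set H : ℂ[X] := ∏ t ∈ T, (X - C t) with hH
  have hH0 : H.eval (z i₀) ≠ 0 := by
    rw [hH, eval_prod, Finset.prod_ne_zero_iff]
    intro t ht
    simp only [eval_sub, eval_X, eval_C, sub_ne_zero]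
    exact fun e => (Finset.mem_erase.mp ht).1 e.symm
  have hHz : ∀ i, z i ≠ z i₀ → H.eval (z i) = 0 := by
    intro i hi
    rw [hH, eval_prod]
    refine Finset.prod_eq_zero (i := z i) ?_ (by simp)
    simp [hT, hi]
  set c : ℕ := (Finset.univ.filter fun i => z i = z i₀).card with hc
  have hcpos : 0 < c := Finset.card_pos.mpr ⟨i₀, by simp⟩
  have key : ∀ s : ℕ, (c : ℂ) * H.eval (z i₀) * z i₀ ^ s =
      ∑ l ∈ Finset.range (H.natDegree + 1), H.coeff l * ∑ i, z i ^ (l + s) := by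
    intro s
    have : ∑ i, H.eval (z i) * z i ^ s = (c : ℂ) * H.eval (z i₀) * z i₀ ^ s := by
      rw [← Finset.sum_filter_add_sum_filter_not Finset.univ (fun i => z i = z i₀)]
      rw [Finset.sum_eq_zero (s := Finset.univ.filter fun i => ¬ z i = z i₀), add_zero]
      · rw [Finset.sum_congr rfl (g := fun _ => H.eval (z i₀) * z i₀ ^ s)]
        · rw [Finset.sum_const, nsmul_eq_mul, hc, mul_assoc]
        · intro i hi; rw [(Finset.mem_filter.mp hi).2]
      · intro i hi; rw [hHz i (Finset.mem_filter.mp hi).2, zero_mul]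
    rw [← this]
    simp_rw [eval_eq_sum_range, Finset.mul_sum, Finset.sum_mul]
    rw [Finset.sum_comm]
    refine Finset.sum_congr rfl fun l _ => Finset.sum_congr rfl fun i _ => ?_
    rw [pow_add, mul_assoc]
  have bound : ∀ s : ℕ, 1 ≤ s → ‖(c : ℂ) * H.eval (z i₀)‖ * ‖z i₀‖ ^ s ≤
      ∑ l ∈ Finset.range (H.natDegree + 1), ‖H.coeff l‖ * B := by
    intro s hs
    rw [← norm_pow, ← norm_mul, key s]
    refine (norm_sum_le _ _).trans (Finset.sum_le_sum fun l _ => ?_)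
    rw [norm_mul]
    exact mul_le_mul_of_nonneg_left (h _ (by omega)) (norm_nonneg _)
  have hpos : 0 < ‖(c : ℂ) * H.eval (z i₀)‖ := by
    rw [norm_pos_iff]
    exact mul_ne_zero (by exact_mod_cast hcpos.ne') hH0
  obtain ⟨s, hs⟩ := pow_unbounded_of_one_lt
    ((∑ l ∈ Finset.range (H.natDegree + 1), ‖H.coeff l‖ * B) / ‖(c : ℂ) * H.eval (z i₀)‖) hlt
  rw [div_lt_iff₀ hpos] at hs
  have h1 := bound (s + 1) (by omega)
  have h2 : ‖z i₀‖ ^ s ≤ ‖z i₀‖ ^ (s + 1) := pow_le_pow_right₀ hlt.le (by omega)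
  nlinarith

theorem exists_power_sum_of_newton_recurrence (N : ℕ) (c S : ℕ → ℂ) (hc0 : c 0 = 1)
    (hcN : ∀ m, N < m → c m = 0)
    (hrec : ∀ m : ℕ, 1 ≤ m → (m : ℂ) * c m = ∑ k ∈ Finset.Icc 1 m, S k * c (m - k)) :
    ∃ ω : Fin N → ℂ, ∀ k : ℕ, 1 ≤ k → S k = -∑ i, ω i ^ k := by
  set L : ℂ[X] := ∑ j ∈ Finset.range (N + 1), C (c j) * X ^ (N - j) with hL
  have hcoeff : ∀ j, j ≤ N → L.coeff (N - j) = c j := by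
    intro j hj
    rw [hL, finsetSum_coeff, Finset.sum_eq_single j]
    · simp
    · intro b hb hbj
      rw [coeff_C_mul, coeff_X_pow, if_neg, mul_zero]
      have := Finset.mem_range.mp hb
      omega
    · intro h; exact absurd (Finset.mem_range.mpr (by omega)) h
  have hdeg : L.natDegree ≤ N := by
    refine natDegree_sum_le_of_forall_le _ _ fun j _ => ?_
    exact (natDegree_C_mul_X_pow_le _ _).trans (by omega)
  have hlc : L.coeff N = 1 := by simpa [hc0] using hcoeff 0 (by omega)
  have hnat : L.natDegree = N := le_antisymm hdeg (le_natDegree_of_ne_zero (by simp [hlc]))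
  have hroots : L.roots.card = L.natDegree :=
    splits_iff_card_roots.mp (IsAlgClosed.splits L)
  obtain ⟨ω, hω⟩ : ∃ ω : Fin N → ℂ, Finset.univ.val.map ω = L.roots := by
    have hlen : L.roots.toList.length = N := by simp [hroots, hnat]
    refine ⟨fun i => L.roots.toList.get (i.cast hlen.symm), ?_⟩
    rw [Fin.univ_val_map]
    conv_rhs => rw [← Multiset.coe_toList L.roots]
    congr 1
    refine List.ext_get (by simp [hlen]) fun i h1 h2 => ?_
    simp
  have hesymm : ∀ j, c j = (-1) ^ j * L.roots.esymm j := by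
    intro j
    rcases le_or_gt j N with hj | hj
    · rw [← hcoeff j hj, coeff_eq_esymm_roots_of_card hroots (by omega), hnat,
        leadingCoeff, hnat, hlc, one_mul, Nat.sub_sub_self hj]
    · rw [hcN j hj, Multiset.esymm, Multiset.powersetCard_eq_empty _ (by omega)]
      simp
  refine ⟨ω, ?_⟩
  have newton : ∀ m : ℕ, 1 ≤ m → (m : ℂ) * c m =
      ∑ k ∈ Finset.Icc 1 m, (-∑ i, ω i ^ k) * c (m - k) := by
    intro m hm
    have h := congrArg (MvPolynomial.aeval ω) (MvPolynomial.mul_esymm_eq_sum (Fin N) ℂ m)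
    simp only [map_mul, map_natCast, map_sum, map_pow, map_neg, map_one,
      MvPolynomial.aeval_esymm_eq_multiset_esymm, hω, MvPolynomial.psum,
      MvPolynomial.aeval_X] at h
    rw [hesymm m]
    have : (m : ℂ) * ((-1) ^ m * L.roots.esymm m) =
      (-1) ^ m * ((m : ℂ) * L.roots.esymm m) := by ring
    rw [this, h, ← mul_assoc, ← pow_add, show m + (m + 1) = 2 * m + 1 by ring,
      pow_succ, pow_mul, neg_one_sq, one_pow, one_mul, neg_one_mul, ← Finset.sum_neg_distrib]
    symm
    refine Finset.sum_bij' (fun k _ => (m - k, k)) (fun a _ => a.2) ?_ ?_ ?_ ?_ ?_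
    · intro k hk
      simp only [Finset.mem_Icc] at hk
      simp only [Finset.mem_filter, Finset.HasAntidiagonal.mem_antidiagonal]
      omega
    · intro a ha
      simp only [Finset.mem_filter, Finset.HasAntidiagonal.mem_antidiagonal] at ha
      simp only [Finset.mem_Icc]
      omega
    · intro k hk; rfl
    · intro a ha
      simp only [Finset.mem_filter, Finset.HasAntidiagonal.mem_antidiagonal] at ha
      ext <;> simp; omega
    · intro k hk
      simp only [hesymm]
      ring
  intro k
  induction k using Nat.strong_induction_on with
  | _ k ih =>
    intro hk
    have h := (hrec k hk).symm.trans (newton k hk)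
    rw [← sub_eq_zero, ← Finset.sum_sub_distrib, Finset.sum_eq_single k] at h
    · simpa [hc0, eq_neg_iff_add_eq_zero] using h
    · intro b hb hbk
      have := Finset.mem_Icc.mp hb
      rw [ih b (by omega) (by omega), sub_self]
    · intro h'; exact absurd (Finset.mem_Icc.mpr ⟨hk, le_rfl⟩) h'

theorem X_pow_mul_linear_independent {L ι : Type*} [Field L] [Fintype ι] (N : ι → ℕ)
    (hN : Function.Injective N) (u : ι → L[X]) (hu : ∀ i, (u i).eval 0 ≠ 0) :
    LinearIndependent L fun i => X ^ N i * u i := by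
  classical
  rw [Fintype.linearIndependent_iff]
  intro a ha
  by_contra! hne
  obtain ⟨i₀, hi₀⟩ := hne
  obtain ⟨i, hi, hmin⟩ := Finset.exists_min_image (Finset.univ.filter fun i => a i ≠ 0) N
    ⟨i₀, by simpa using hi₀⟩
  have h := congrArg (fun f => coeff f (N i)) ha
  simp only [finsetSum_coeff, coeff_smul, coeff_zero] at h
  rw [Finset.sum_eq_single i] at h
  · have h2 : (X ^ N i * u i).coeff (N i) = (u i).eval 0 := by
      rw [← coeff_zero_eq_eval_zero]
      simpa using coeff_X_pow_mul (u i) (N i) 0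
    rw [h2, smul_eq_mul] at h
    exact mul_ne_zero (Finset.mem_filter.mp hi).2 (hu i) h
  · intro b _ hb
    by_cases hab : a b = 0
    · simp [hab]
    · have h1 := hmin b (by simpa using hab)
      have h2 : N b ≠ N i := fun e => hb (hN e)
      rw [coeff_X_pow_mul', if_neg (by omega), smul_zero]
  · simp

/-- Stepanov's bound for the number of fixed points of the `r ^ 2`-power map at which
`(X * g₁) ^ (w * (r + 1))` takes a given nonzero value. -/
theorem stepanov_bound {L : Type*} [Field L] [IsAlgClosed L] (p μ : ℕ) [ExpChar L p]
    (r d w D : ℕ) (hr : r = p ^ μ) (hr4 : 4 ≤ r) (hd : 2 ≤ d) (hdw : d * w + 1 = r)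
    (g₁ : L[X]) (hg₁ : g₁.eval 0 ≠ 0) (hD : (X * g₁).natDegree ≤ D) (ζ : L) (hζ : ζ ≠ 0)
    (S : Finset L)
    (hS : ∀ x ∈ S, x ^ (r * r) = x ∧ ((X * g₁).eval x) ^ (w * (r + 1)) = ζ) :
    d * S.card ≤ r * r + d * (3 * D + 2) * r := by
  classical
  set g : L[X] := X * g₁ with hg
  set M : ℕ := w + (2 * D + 2) with hM
  set R : ℕ := r * w + M + r * D with hR
  have hw : 0 < w := by
    rcases Nat.eq_zero_or_pos w with h | h
    · subst h; omega
    · exact h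
  have hdwr : (d - 1) * w ≤ r := by
    rw [← hdw]; nlinarith [Nat.sub_le d 1]
  have hw2 : 2 * w + 1 ≤ r := by nlinarith
  have hjw : ∀ j, j < d → D * (j * w) ≤ D * r := by
    intro j hj
    refine Nat.mul_le_mul_left _ (le_trans (Nat.mul_le_mul_right _ ?_) hdwr)
    omega
  have hgdeg : ∀ j, (g ^ j).natDegree ≤ D * j := fun j =>
    natDegree_pow_le.trans (by rw [mul_comm]; exact Nat.mul_le_mul_right _ hD)
  let V : Fin d × Fin M × Fin w → L[X] := fun t =>
    X ^ (r * (t.2.2 : ℕ)) * (C (ζ ^ (t.1 : ℕ)) * g ^ ((d - 1 - t.1) * w)) * X ^ (t.2.1 : ℕ)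
  have hV : ∀ t, V t ∈ degreeLT L R := by
    rintro ⟨j, k, i⟩
    rw [mem_degreeLT]
    refine lt_of_le_of_lt degree_le_natDegree ?_
    rw [Nat.cast_lt]
    have h1 : (V (j, k, i)).natDegree ≤ r * i + D * ((d - 1 - j) * w) + k := by
      refine natDegree_mul_le_of_le (natDegree_mul_le_of_le (natDegree_X_pow_le _) ?_)
        (natDegree_X_pow_le _)
      exact (natDegree_C_mul_le _ _).trans (hgdeg _)
    have h2 := hjw (d - 1 - j) (by omega)
    have h3 : r * (i : ℕ) ≤ r * w := Nat.mul_le_mul_left _ i.2.le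
    have h4 := k.2
    rw [mul_comm D r] at h2
    omega
  obtain ⟨γ, hγ, t₀, ht₀⟩ : ∃ γ : Fin d × Fin M × Fin w → L,
      ∑ t, γ t • V t = 0 ∧ ∃ t, γ t ≠ 0 := by
    have hli : ¬ LinearIndependent L fun t => (⟨V t, hV t⟩ : degreeLT L R) := by
      intro hli
      have : Module.Finite L (degreeLT L R) := Module.Finite.equiv (degreeLTEquiv L R).symm
      have h := hli.fintype_card_le_finrank
      rw [(degreeLTEquiv L R).finrank_eq, Module.finrank_fin_fun] at h
      simp only [Fintype.card_prod, Fintype.card_fin] at h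
      have h5 : d * (M * w) = (d * w) * M := by ring
      rw [h5] at h
      have h6 : (d * w) * M + M = r * M := by rw [← hdw]; ring
      have h7 : r * M = r * w + 2 * (r * D) + 2 * r := by rw [hM]; ring
      have h8 : 4 * D ≤ r * D := Nat.mul_le_mul_right _ hr4
      omega
    rw [Fintype.not_linearIndependent_iff] at hli
    obtain ⟨γ, h, hne⟩ := hli
    refine ⟨γ, ?_, hne⟩
    simpa using congrArg (Submodule.subtype _) h
  have hroot : ∀ t, ∃ a : L, a ^ r = γ t := fun t =>
    IsAlgClosed.exists_pow_nat_eq _ (by omega)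
  choose a ha using hroot
  let N : Fin d × Fin M × Fin w → ℕ := fun t => t.2.2 + w * t.1 + r * t.2.1
  have hN : Function.Injective N := by
    have aux : ∀ t : Fin d × Fin M × Fin w, (t.2.2 : ℕ) + w * t.1 < r := by
      rintro ⟨j, k, i⟩
      have h1 : w * (j + 1) ≤ w * d := Nat.mul_le_mul_left _ j.2
      have h2 := i.2
      simp only
      rw [mul_comm w d] at h1
      rw [mul_add] at h1
      omega
    intro s t hst
    have e1 := congrArg (· % r) hst
    have e2 := congrArg (· / r) hst
    simp only [N, Nat.add_mul_mod_self_left, Nat.mod_eq_of_lt (aux _),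
      Nat.add_mul_div_left _ _ (show 0 < r by omega), Nat.div_eq_of_lt (aux _), zero_add] at e1 e2
    have e3 := congrArg (· % w) e1
    have e4 := congrArg (· / w) e1
    simp only [Nat.add_mul_mod_self_left, Nat.mod_eq_of_lt (Fin.is_lt _),
      Nat.add_mul_div_left _ _ hw, Nat.div_eq_of_lt (Fin.is_lt _), zero_add] at e3 e4
    ext <;> assumption
  set P : L[X] := ∑ t, a t • (X ^ N t * g₁ ^ ((t.1 : ℕ) * w)) with hP
  have hP0 : P ≠ 0 := by
    intro h0
    have hli := X_pow_mul_linear_independent N hN (fun t => g₁ ^ ((t.1 : ℕ) * w))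
      (fun t => by rw [eval_pow]; exact pow_ne_zero _ hg₁)
    rw [Fintype.linearIndependent_iff] at hli
    have := hli a h0 t₀
    rw [← ha, this] at ht₀
    exact ht₀ (zero_pow (by omega))
  have hPg : P = ∑ t, a t • (X ^ (t.2.2 : ℕ) * g ^ ((t.1 : ℕ) * w) * X ^ (r * (t.2.1 : ℕ))) := by
    refine Finset.sum_congr rfl fun t _ => ?_
    congr 1
    simp only [N, hg, mul_pow, pow_add, mul_comm w]
    ring
  have hPdeg : P.natDegree ≤ w + r * D + r * (w + (2 * D + 1)) := by
    rw [hPg]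
    refine natDegree_sum_le_of_forall_le _ _ ?_
    rintro ⟨j, k, i⟩ -
    refine (natDegree_smul_le _ _).trans ?_
    have h1 : (X ^ (i : ℕ) * g ^ ((j : ℕ) * w) * X ^ (r * (k : ℕ))).natDegree ≤
        i + D * (j * w) + r * k :=
      natDegree_mul_le_of_le (natDegree_mul_le_of_le (natDegree_X_pow_le _) (hgdeg _))
        (natDegree_X_pow_le _)
    refine h1.trans ?_
    have h2 := hjw j j.2
    have h3 : r * (k : ℕ) ≤ r * (w + (2 * D + 1)) := Nat.mul_le_mul_left _ (by omega)
    rw [mul_comm D r] at h2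
    omega
  have hzero : ∀ x ∈ S, P.IsRoot x := by
    intro x hx
    obtain ⟨hx1, hx2⟩ := hS x hx
    have hgx : g.eval x ≠ 0 := by
      intro h0
      rw [h0, zero_pow (by positivity)] at hx2
      exact hζ hx2.symm
    have hid : (g.eval x) ^ ((d - 1) * w) * (P.eval x) ^ r = (∑ t, γ t • V t).eval x := by
      rw [hPg, eval_finsetSum, eval_finsetSum, hr, sum_pow_char_pow, ← hr, Finset.mul_sum]
      refine Finset.sum_congr rfl ?_
      rintro ⟨j, k, i⟩ -
      simp only [V, eval_smul, eval_mul, eval_pow, eval_X, eval_C, smul_eq_mul, ← ha, ← hx2]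
      have hk : (x ^ (r * (k : ℕ))) ^ r = x ^ (k : ℕ) := by
        rw [← pow_mul, show r * (k : ℕ) * r = r * r * k by ring, pow_mul, hx1]
      have hsplit : (d - 1) * w = (d - 1 - j) * w + j * w := by
        rw [← add_mul]; congr 1; omega
      rw [mul_pow, mul_pow, mul_pow, hk, hsplit]
      ring
    rw [hγ, eval_zero] at hid
    have := (mul_eq_zero.mp hid).resolve_left (pow_ne_zero _ hgx)
    exact pow_eq_zero_iff (by omega) |>.mp this
  have hcard : S.card ≤ P.natDegree := by
    refine card_le_degree_of_subset_roots (p := P) ?_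
    intro x hx
    exact (mem_roots hP0).mpr (hzero x hx)
  have h1 : S.card ≤ w * r + (3 * D + 2) * r := by
    have : w + r * D + r * (w + (2 * D + 1)) = w * r + w + 3 * (D * r) + r := by ring
    have h2 : (3 * D + 2) * r = 3 * (D * r) + 2 * r := by ring
    omega
  calc d * S.card ≤ d * (w * r + (3 * D + 2) * r) := Nat.mul_le_mul_left _ h1
    _ = (d * w) * r + d * (3 * D + 2) * r := by ring
    _ ≤ r * r + d * (3 * D + 2) * r := by
        gcongr
        omega

theorem MulChar.ite_eq_sub_sum_pow {E : Type*} [Field E] [Fintype E] {ℓ : ℕ} (hℓ : 0 < ℓ)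
    {ψ : MulChar E ℂ} (hψ : orderOf ψ = ℓ) {u : E} (hu : u ≠ 0) :
    (if ψ u = 1 then (0 : ℂ) else 1) =
      (1 - 1 / (ℓ : ℂ)) - 1 / (ℓ : ℂ) * ∑ j ∈ Finset.Ico 1 ℓ, (ψ ^ j) u := by
  have hℓ' : (ℓ : ℂ) ≠ 0 := by exact_mod_cast hℓ.ne'
  have hval : ∀ j, (ψ ^ j) u = ψ u ^ j := fun j => MulChar.pow_apply_coe ψ j (Units.mk0 u hu)
  have hsum : ∑ j ∈ Finset.Ico 1 ℓ, (ψ ^ j) u = (∑ j ∈ Finset.range ℓ, ψ u ^ j) - 1 := by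
    rw [Finset.range_eq_Ico, Finset.sum_eq_sum_Ico_succ_bot hℓ]
    simp [hval]
  have hone : ψ u ^ ℓ = 1 := by
    rw [← hval, ← hψ, pow_orderOf_eq_one, MulChar.one_apply (isUnit_iff_ne_zero.mpr hu)]
  rw [hsum]
  split_ifs with h
  · simp only [h, one_pow, Finset.sum_const, Finset.card_range, nsmul_eq_mul, mul_one]
    field_simp
    ring
  · have : ∑ j ∈ Finset.range ℓ, ψ u ^ j = 0 := by
      rw [geom_sum_eq h, hone, sub_self, zero_div]
    rw [this]
    ring

theorem MulChar.sieve_bound {E ι : Type*} [Field E] [Fintype E] [Fintype ι] (v : ι → E)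
    (hv : ∀ a, v a ≠ 0) (B : ℝ)
    (hB : ∀ χ : MulChar E ℂ, χ ≠ 1 → ‖∑ a, χ (v a)‖ ≤ B)
    (ψ : ℕ → MulChar E ℂ) (s : Finset ℕ) (hs : ∀ ℓ ∈ s, ℓ.Prime)
    (hψ : ∀ ℓ ∈ s, orderOf (ψ ℓ) = ℓ) :
    ∀ χ : MulChar E ℂ, (∀ ℓ ∈ s, (orderOf χ).Coprime ℓ) →
      (χ ≠ 1 → ‖∑ a, χ (v a) * ∏ ℓ ∈ s, (if ψ ℓ (v a) = 1 then (0 : ℂ) else 1)‖ ≤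
        (∏ ℓ ∈ s, (1 - 1 / (ℓ : ℝ))) * 2 ^ s.card * B) ∧
      (χ = 1 → ‖∑ a, χ (v a) * ∏ ℓ ∈ s, (if ψ ℓ (v a) = 1 then (0 : ℂ) else 1) -
          (((∏ ℓ ∈ s, (1 - 1 / (ℓ : ℝ))) * Fintype.card ι : ℝ) : ℂ)‖ ≤
        (∏ ℓ ∈ s, (1 - 1 / (ℓ : ℝ))) * (2 ^ s.card - 1) * B) := by
  classical
  induction s using Finset.induction_on with
  | empty =>
    intro χ _
    refine ⟨fun h => by simpa using hB χ h, ?_⟩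
    rintro rfl
    simp [MulChar.one_apply, hv]
  | insert ℓ s hℓs ih =>
    have ih := ih (fun l hl => hs l (Finset.mem_insert_of_mem hl))
      (fun l hl => hψ l (Finset.mem_insert_of_mem hl))
    have hℓ : ℓ.Prime := hs ℓ (Finset.mem_insert_self _ _)
    have hord : orderOf (ψ ℓ) = ℓ := hψ ℓ (Finset.mem_insert_self _ _)
    have hℓ1 : (1 : ℝ) ≤ ℓ := by exact_mod_cast hℓ.one_lt.le
    set θ : ℝ := ∏ l ∈ s, (1 - 1 / (l : ℝ)) with hθ
    set T : MulChar E ℂ → ℂ := fun χ =>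
      ∑ a, χ (v a) * ∏ l ∈ s, (if ψ l (v a) = 1 then (0 : ℂ) else 1) with hT
    have hstep : ∀ χ : MulChar E ℂ,
        ∑ a, χ (v a) * ∏ l ∈ insert ℓ s, (if ψ l (v a) = 1 then (0 : ℂ) else 1) =
          ((1 - 1 / (ℓ : ℝ) : ℝ) : ℂ) * T χ -
            1 / (ℓ : ℂ) * ∑ j ∈ Finset.Ico 1 ℓ, T (χ * ψ ℓ ^ j) := by
      intro χ
      simp only [hT]
      rw [Finset.sum_comm, Finset.mul_sum, Finset.mul_sum, ← Finset.sum_sub_distrib]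
      refine Finset.sum_congr rfl fun a _ => ?_
      rw [Finset.prod_insert hℓs, MulChar.ite_eq_sub_sum_pow hℓ.pos hord (hv a)]
      simp only [MulChar.mul_apply]
      rw [← Finset.sum_mul, ← Finset.mul_sum]
      push_cast
      ring
    have herr : ∀ χ : MulChar E ℂ, (∀ l ∈ insert ℓ s, (orderOf χ).Coprime l) →
        ‖1 / (ℓ : ℂ) * ∑ j ∈ Finset.Ico 1 ℓ, T (χ * ψ ℓ ^ j)‖ ≤
          (1 - 1 / (ℓ : ℝ)) * (θ * 2 ^ s.card * B) := by
      intro χ hχ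
      have hj : ∀ j ∈ Finset.Ico 1 ℓ, ‖T (χ * ψ ℓ ^ j)‖ ≤ θ * 2 ^ s.card * B := by
        intro j hj
        obtain ⟨hj1, hj2⟩ := Finset.mem_Ico.mp hj
        have hdvd : orderOf (ψ ℓ ^ j) ∣ ℓ := (orderOf_pow_dvd j).trans hord.dvd
        refine (ih (χ * ψ ℓ ^ j) ?_).1 ?_
        · intro l hl
          have h1 := (Commute.all χ (ψ ℓ ^ j)).orderOf_mul_dvd_mul_orderOf
          refine Nat.Coprime.coprime_dvd_left h1 (Nat.Coprime.mul_left
            (hχ l (Finset.mem_insert_of_mem hl)) (Nat.Coprime.coprime_dvd_left hdvd ?_))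
          refine (Nat.coprime_primes hℓ (hs l (Finset.mem_insert_of_mem hl))).mpr ?_
          rintro rfl
          exact hℓs hl
        · intro h
          have h1 : orderOf χ = orderOf (ψ ℓ ^ j) := by
            rw [mul_eq_one_iff_eq_inv.mp h, orderOf_inv]
          have h2 := hχ ℓ (Finset.mem_insert_self _ _)
          rw [h1] at h2
          have h3 := Nat.Coprime.eq_one_of_dvd h2 hdvd
          rw [orderOf_eq_one_iff] at h3
          have h4 := orderOf_dvd_of_pow_eq_one h3
          rw [hord] at h4
          have := Nat.le_of_dvd (by omega) h4
          omega
      rw [norm_mul, norm_div, norm_one, Complex.norm_natCast]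
      have h1 := (norm_sum_le _ _).trans (Finset.sum_le_sum hj)
      rw [Finset.sum_const, Nat.card_Ico, nsmul_eq_mul, Nat.cast_sub hℓ.one_lt.le] at h1
      calc _ ≤ 1 / (ℓ : ℝ) * ((ℓ - (1 : ℕ)) * (θ * 2 ^ s.card * B)) := by gcongr
        _ = _ := by field_simp; push_cast; ring
    have h0 : 0 ≤ 1 - 1 / (ℓ : ℝ) := by
      rw [sub_nonneg]; exact div_le_one_of_le₀ hℓ1 (by positivity)
    intro χ hχ
    rw [hstep, Finset.prod_insert hℓs, Finset.card_insert_of_notMem hℓs, pow_succ]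
    have ihχ := ih χ fun l hl => hχ l (Finset.mem_insert_of_mem hl)
    refine ⟨fun h1 => ?_, fun h1 => ?_⟩
    · refine (norm_sub_le _ _).trans ?_
      rw [norm_mul, Complex.norm_real, Real.norm_of_nonneg h0]
      have h2 := mul_le_mul_of_nonneg_left (ihχ.1 h1) h0
      have h3 := herr χ hχ
      calc _ ≤ _ := add_le_add h2 h3
        _ = _ := by ring
    · have h2 := mul_le_mul_of_nonneg_left (ihχ.2 h1) h0
      have h3 := herr χ hχ
      have h4 : ((1 - 1 / (ℓ : ℝ) : ℝ) : ℂ) * T χ -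
            1 / (ℓ : ℂ) * ∑ j ∈ Finset.Ico 1 ℓ, T (χ * ψ ℓ ^ j) -
          (((1 - 1 / (ℓ : ℝ)) * θ * Fintype.card ι : ℝ) : ℂ) =
          ((1 - 1 / (ℓ : ℝ) : ℝ) : ℂ) * (T χ - ((θ * Fintype.card ι : ℝ) : ℂ)) -
            1 / (ℓ : ℂ) * ∑ j ∈ Finset.Ico 1 ℓ, T (χ * ψ ℓ ^ j) := by
        push_cast; ring
      rw [h4]
      refine (norm_sub_le _ _).trans ?_
      rw [norm_mul, Complex.norm_real, Real.norm_of_nonneg h0]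
      calc _ ≤ _ := add_le_add h2 h3
        _ = _ := by ring

theorem two_pow_card_primeFactors_eq_Wnat {m : ℕ} (hm : 0 < m) :
    2 ^ m.primeFactors.card = Wnat m := by
  classical
  have h := Nat.sum_divisors_filter_squarefree hm.ne' (f := fun _ => 1)
  rw [Finset.sum_const, Finset.sum_const, smul_eq_mul, smul_eq_mul, mul_one, mul_one,
    Finset.card_powerset] at h
  have h1 : (UniqueFactorizationMonoid.normalizedFactors m).toFinset = m.primeFactors := by
    rw [Nat.factors_eq]; rfl
  rw [← h1, ← h, Wnat]
  refine (Nat.subtype_card _ fun d => ?_).symm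
  simp [hm.ne']

section FrobeniusFixed

variable (F : Type*) {L : Type*} [Field F] [Fintype F] [Field L] [Algebra F L]

open Classical in
/-- The elements of `L` fixed by the `k`-th power of the `q`-Frobenius, for `k ≠ 0`. -/
def frobFixed (L : Type*) [Field L] (q k : ℕ) : Finset L :=
  (X ^ q ^ k - X : L[X]).roots.toFinset

/-- The characteristic polynomial over `F` of an element `x` of the extension of `F` of
degree `k`. -/
def charPow (x : L) (k : ℕ) : F[X] :=
  minpoly F x ^ (k / (minpoly F x).natDegree)

theorem finite_setOf_monic_natDegree_eq (m : ℕ) :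
    {g : F[X] | g.Monic ∧ g.natDegree = m}.Finite := by
  have : Module.Finite F (degreeLT F (m + 1)) :=
    Module.Finite.equiv (degreeLTEquiv F (m + 1)).symm
  have : Finite (degreeLT F (m + 1)) := Module.finite_of_finite F
  refine (Set.toFinite (degreeLT F (m + 1) : Set F[X])).subset ?_
  rintro g ⟨-, rfl⟩
  rw [SetLike.mem_coe, mem_degreeLT]
  exact degree_le_natDegree.trans_lt (by exact_mod_cast Nat.lt_succ_self _)

/-- The finite set of monic polynomials of degree `m` over a finite field. -/
def monics (m : ℕ) : Finset F[X] := (finite_setOf_monic_natDegree_eq F m).toFinset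

variable {F}

theorem mem_monics {m : ℕ} {g : F[X]} : g ∈ monics F m ↔ g.Monic ∧ g.natDegree = m := by
  simp [monics]

theorem mem_frobFixed {q k : ℕ} (hq : 1 < q) (hk : k ≠ 0) {x : L} :
    x ∈ frobFixed L q k ↔ x ^ q ^ k = x := by
  classical
  rw [frobFixed, Multiset.mem_toFinset,
    mem_roots (FiniteField.X_pow_card_pow_sub_X_ne_zero L hk hq)]
  simp [sub_eq_zero]

variable [Algebra.IsAlgebraic F L]

theorem pow_card_pow_eq_self_iff {x : L} {k : ℕ} :
    x ^ Fintype.card F ^ k = x ↔ (minpoly F x).natDegree ∣ k := by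
  rw [(minpoly.irreducible (Algebra.IsIntegral.isIntegral
    (R := F) x)).natDegree_dvd_iff_dvd_X_pow_card_pow_sub_X, minpoly.dvd_iff,
    Nat.card_eq_fintype_card]
  simp [sub_eq_zero]

theorem charPow_mem_monics {x : L} {k : ℕ} (hx : (minpoly F x).natDegree ∣ k) :
    charPow F x k ∈ monics F k := by
  have hm := minpoly.monic (Algebra.IsIntegral.isIntegral (R := F) x)
  rw [mem_monics, charPow]
  refine ⟨hm.pow _, ?_⟩
  rw [natDegree_pow, Nat.div_mul_cancel hx]

open Classical in
theorem card_filter_charPow_dvd {g : F[X]} (hg : g.Monic) (x : L) :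
    ((Finset.Icc 1 g.natDegree).filter fun k =>
        x ^ Fintype.card F ^ k = x ∧ charPow F x k ∣ g).card =
      (g.map (algebraMap F L)).roots.count x := by
  classical
  set P := minpoly F x with hP
  have hintegral : IsIntegral F x := Algebra.IsIntegral.isIntegral x
  have hirr : Irreducible P := minpoly.irreducible hintegral
  have he : 0 < P.natDegree := minpoly.natDegree_pos hintegral
  have hfin : FiniteMultiplicity P g :=
    FiniteMultiplicity.of_not_isUnit hirr.not_isUnit hg.ne_zero
  obtain ⟨g₁, hgg, hPg₁⟩ := hfin.exists_eq_pow_mul_and_not_dvd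
  set v := multiplicity P g with hv
  have hdvd : ∀ j, P ^ j ∣ g ↔ j ≤ v := fun j => hfin.pow_dvd_iff_le_multiplicity
  have hcount : (g.map (algebraMap F L)).roots.count x = v := by
    have hne : (g.map (algebraMap F L)) ≠ 0 := (hg.map _).ne_zero
    have h1 : g.map (algebraMap F L) =
        (P.map (algebraMap F L)) ^ v * g₁.map (algebraMap F L) := by
      conv_lhs => rw [hgg]
      rw [Polynomial.map_mul, Polynomial.map_pow]
    have hsep : (P.map (algebraMap F L)).Separable :=
      (PerfectField.separable_of_irreducible hirr).map
    have hroot : x ∈ (P.map (algebraMap F L)).roots := by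
      rw [mem_roots (Polynomial.map_ne_zero hirr.ne_zero), IsRoot.def, eval_map_algebraMap,
        hP, minpoly.aeval]
    have h2 : (P.map (algebraMap F L)).roots.count x = 1 :=
      Multiset.count_eq_one_of_mem (nodup_roots hsep) hroot
    have h3 : (g₁.map (algebraMap F L)).roots.count x = 0 := by
      rw [Multiset.count_eq_zero]
      intro hmem
      have := (mem_roots'.mp hmem).2
      rw [IsRoot.def, eval_map_algebraMap, ← minpoly.dvd_iff] at this
      exact hPg₁ this
    rw [h1] at hne ⊢
    rw [roots_mul hne, roots_pow, Multiset.count_add, Multiset.count_nsmul, h2, h3]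
    simp
  rw [hcount]
  have himage : ((Finset.Icc 1 g.natDegree).filter fun k =>
      x ^ Fintype.card F ^ k = x ∧ charPow F x k ∣ g) =
      (Finset.Icc 1 v).image fun j => P.natDegree * j := by
    ext k
    simp only [Finset.mem_filter, Finset.mem_Icc, Finset.mem_image, pow_card_pow_eq_self_iff,
      charPow, ← hP, hdvd]
    constructor
    · rintro ⟨⟨hk1, hk2⟩, ⟨j, rfl⟩, hj⟩
      rw [Nat.mul_div_cancel_left _ he] at hj
      exact ⟨j, ⟨Nat.pos_of_mul_pos_left hk1, hj⟩, rfl⟩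
    · rintro ⟨j, ⟨hj1, hj2⟩, rfl⟩
      refine ⟨⟨Nat.mul_pos he hj1, ?_⟩, dvd_mul_right _ _, ?_⟩
      · have := natDegree_le_of_dvd ((hdvd j).mpr hj2) hg.ne_zero
        rwa [natDegree_pow, mul_comm] at this
      · rwa [Nat.mul_div_cancel_left _ he]
  rw [himage, Finset.card_image_of_injective _ (fun a b h => Nat.eq_of_mul_eq_mul_left he h)]
  simp

open Classical in
theorem sum_card_filter_charPow_dvd [IsAlgClosed L] {m : ℕ} {g : F[X]}
    (hg : g ∈ monics F m) :
    ∑ k ∈ Finset.Icc 1 m,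
      ((frobFixed L (Fintype.card F) k).filter fun x => charPow F x k ∣ g).card = m := by
  classical
  obtain ⟨hmon, rfl⟩ := mem_monics.mp hg
  set G := g.map (algebraMap F L) with hG
  have hGne : G ≠ 0 := (hmon.map _).ne_zero
  have hroot : ∀ x : L, x ∈ G.roots.toFinset ↔ aeval x g = 0 := by
    intro x
    rw [Multiset.mem_toFinset, mem_roots hGne, IsRoot.def, eval_map_algebraMap]
  have h1 : ∀ k ∈ Finset.Icc 1 g.natDegree,
      ((frobFixed L (Fintype.card F) k).filter fun x => charPow F x k ∣ g) =
      G.roots.toFinset.filter fun x => x ^ Fintype.card F ^ k = x ∧ charPow F x k ∣ g := by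
    intro k hk
    have hk1 := (Finset.mem_Icc.mp hk).1
    ext x
    simp only [Finset.mem_filter, mem_frobFixed Fintype.one_lt_card (show k ≠ 0 by omega), hroot]
    refine ⟨fun h => ⟨?_, h⟩, fun h => h.2⟩
    obtain ⟨hx, u, hu⟩ := h
    rw [hu, map_mul, charPow, map_pow, minpoly.aeval, zero_pow, zero_mul]
    have hdvd := pow_card_pow_eq_self_iff.mp hx
    exact (Nat.div_pos (Nat.le_of_dvd hk1 hdvd)
      (minpoly.natDegree_pos (Algebra.IsIntegral.isIntegral x))).ne'
  rw [Finset.sum_congr rfl fun k hk => congrArg Finset.card (h1 k hk)]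
  simp only [Finset.card_filter]
  rw [Finset.sum_comm]
  simp only [← Finset.card_filter]
  rw [Finset.sum_congr rfl fun x _ => card_filter_charPow_dvd hmon x,
    Multiset.toFinset_sum_count_eq, splits_iff_card_roots.mp (IsAlgClosed.splits G), hG,
    natDegree_map]

theorem newton_recurrence_monics (F L : Type*) [Field F] [Fintype F] [Field L] [Algebra F L]
    [Algebra.IsAlgebraic F L] [IsAlgClosed L] (lam : F[X] →* ℂ) (m : ℕ) :
    (m : ℂ) * ∑ g ∈ monics F m, lam g =
      ∑ k ∈ Finset.Icc 1 m, (∑ x ∈ frobFixed L (Fintype.card F) k, lam (charPow F x k)) *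
        ∑ g ∈ monics F (m - k), lam g := by
  classical
  have h1 : (m : ℂ) * ∑ g ∈ monics F m, lam g =
      ∑ g ∈ monics F m, ∑ k ∈ Finset.Icc 1 m, ∑ x ∈ frobFixed L (Fintype.card F) k,
        if charPow F x k ∣ g then lam g else 0 := by
    rw [Finset.mul_sum]
    refine Finset.sum_congr rfl fun g hg => ?_
    conv_lhs => rw [← sum_card_filter_charPow_dvd (L := L) hg]
    rw [Nat.cast_sum, Finset.sum_mul]
    refine Finset.sum_congr rfl fun k _ => ?_
    rw [← Finset.sum_filter, Finset.sum_const, nsmul_eq_mul]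
  rw [h1, Finset.sum_comm]
  refine Finset.sum_congr rfl fun k hk => ?_
  obtain ⟨hk1, hk2⟩ := Finset.mem_Icc.mp hk
  rw [Finset.sum_comm, Finset.sum_mul]
  refine Finset.sum_congr rfl fun x hx => ?_
  rw [mem_frobFixed Fintype.one_lt_card (by omega), pow_card_pow_eq_self_iff (F := F)] at hx
  obtain ⟨hmon, hdeg⟩ := mem_monics.mp (charPow_mem_monics hx)
  rw [← Finset.sum_filter, Finset.mul_sum]
  symm
  refine Finset.sum_bij (fun g _ => charPow F x k * g) ?_ ?_ ?_ ?_
  · intro g hg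
    obtain ⟨h2, h3⟩ := mem_monics.mp hg
    rw [Finset.mem_filter, mem_monics]
    refine ⟨⟨hmon.mul h2, ?_⟩, dvd_mul_right _ _⟩
    rw [hmon.natDegree_mul h2, hdeg, h3]
    omega
  · intro a _ b _ hab
    exact mul_left_cancel₀ hmon.ne_zero hab
  · intro g hg
    obtain ⟨hg1, u, rfl⟩ := Finset.mem_filter.mp hg
    obtain ⟨h2, h3⟩ := mem_monics.mp hg1
    have hu : u.Monic := hmon.of_mul_monic_left h2
    refine ⟨u, mem_monics.mpr ⟨hu, ?_⟩, rfl⟩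
    rw [hmon.natDegree_mul hu, hdeg] at h3
    omega
  · intro g _
    rw [map_mul]

theorem aeval_charPow {x : L} {k : ℕ} (hx : (minpoly F x).natDegree ∣ k) (b : L) :
    aeval b (charPow F x k) = ∏ i ∈ Finset.range k, (b - x ^ Fintype.card F ^ i) := by
  classical
  set q := Fintype.card F with hq
  set P := minpoly F x with hP
  have hintegral : IsIntegral F x := Algebra.IsIntegral.isIntegral x
  have he : 0 < P.natDegree := minpoly.natDegree_pos hintegral
  have hmon : P.Monic := minpoly.monic hintegral
  have hfrob : ∀ i y, x ^ q ^ (i + y) = (x ^ q ^ i) ^ q ^ y := fun i y => by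
    rw [pow_add, pow_mul]
  have hxe : x ^ q ^ P.natDegree = x := pow_card_pow_eq_self_iff.mpr dvd_rfl
  have hinj : Set.InjOn (fun i => x ^ q ^ i) (Finset.range P.natDegree) := by
    have aux : ∀ i j, i < j → j < P.natDegree → x ^ q ^ i ≠ x ^ q ^ j := by
      intro i j hij hj h
      have h1 : x ^ q ^ (i + (P.natDegree - i)) = x ^ q ^ (j + (P.natDegree - i)) := by
        rw [hfrob, h, ← hfrob]
      rw [show i + (P.natDegree - i) = P.natDegree by omega,
        show j + (P.natDegree - i) = P.natDegree + (j - i) by omega, hfrob, hxe] at h1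
      have h2 := Nat.le_of_dvd (by omega) (pow_card_pow_eq_self_iff (F := F).mp h1.symm)
      rw [← hP] at h2
      omega
    intro i hi j hj h
    simp only [Finset.coe_range, Set.mem_Iio] at hi hj
    rcases lt_trichotomy i j with hlt | heq | hgt
    · exact absurd h (aux i j hlt hj)
    · exact heq
    · exact absurd h.symm (aux j i hgt hi)
  have hroot : ∀ i, aeval (x ^ q ^ i) P = 0 := by
    intro i
    have hfr : ∀ y : L, aeval (y ^ q) P = (aeval y P) ^ q := by
      intro y
      rw [← map_pow, ← FiniteField.expand_card, expand_aeval]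
    induction i with
    | zero => simp [hP]
    | succ i ih => rw [pow_succ, pow_mul, hfr, ih, zero_pow Fintype.card_ne_zero]
  have hprod : P.map (algebraMap F L) =
      ∏ i ∈ Finset.range P.natDegree, (X - C (x ^ q ^ i)) := by
    refine eq_of_monic_of_dvd_of_natDegree_le (monic_prod_of_monic _ _ fun i _ => monic_X_sub_C _)
      (hmon.map _) ?_ ?_
    · refine Finset.prod_dvd_of_coprime ?_ ?_
      · intro i hi j hj hij
        exact pairwise_coprime_X_sub_C (s := fun y : L => y) Function.injective_id
          (fun h => hij (hinj hi hj h))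
      · intro i _
        rw [dvd_iff_isRoot, IsRoot.def, eval_map_algebraMap, hroot]
    · rw [natDegree_map, natDegree_prod_of_monic _ _ fun i _ => monic_X_sub_C _]
      simp only [natDegree_X_sub_C, Finset.sum_const, Finset.card_range, smul_eq_mul, mul_one,
        le_refl]
  obtain ⟨s, rfl⟩ := hx
  rw [charPow, ← hP, Nat.mul_div_cancel_left _ he, map_pow]
  have h1 : aeval b P = ∏ i ∈ Finset.range P.natDegree, (b - x ^ q ^ i) := by
    rw [← eval_map_algebraMap, hprod, eval_prod]
    simp
  rw [h1]
  clear h1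
  induction s with
  | zero => simp
  | succ s ih =>
    rw [pow_succ, ih, mul_add, mul_one, Finset.prod_range_add]
    congr 1
    refine Finset.prod_congr rfl fun i _ => ?_
    rw [hfrob, pow_card_pow_eq_self_iff.mpr (dvd_mul_right _ _)]

end FrobeniusFixed

section CharacterSums

theorem MulChar.norm_apply_le_one {E : Type*} [Field E] [Fintype E] (χ : MulChar E ℂ) (u : E) :
    ‖χ u‖ ≤ 1 := by
  by_cases hu : u = 0
  · simp [hu]
  · refine (Complex.norm_eq_one_of_pow_eq_one (n := Fintype.card E - 1) ?_ ?_).le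
    · rw [← map_pow, FiniteField.pow_card_sub_one_eq_one u hu, map_one]
    · have := Fintype.one_lt_card (α := E)
      omega

theorem MulChar.norm_sum_mul_le {E : Type*} [Field E] [Fintype E] {χ : MulChar E ℂ}
    (hχ : χ ≠ 1) (A : E → ℝ) (U : ℝ) (hA : ∀ ζ, ζ ≠ 0 → A ζ ≤ U) :
    ‖∑ ζ, χ ζ * (A ζ : ℂ)‖ ≤ ((Fintype.card E - 1 : ℕ) : ℝ) * U - ∑ ζ, A ζ + A 0 := by
  classical
  have h1 : ∑ ζ, χ ζ * (A ζ : ℂ) = ∑ ζ ∈ Finset.univ.erase 0, χ ζ * ((A ζ - U : ℝ) : ℂ) := by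
    rw [Finset.sum_erase _ (by simp)]
    simp only [Complex.ofReal_sub, mul_sub, Finset.sum_sub_distrib, ← Finset.sum_mul,
      MulChar.sum_eq_zero_of_ne_one hχ, zero_mul, sub_zero]
  have h2 : ∑ ζ ∈ Finset.univ.erase 0, (U - A ζ) =
      ((Fintype.card E - 1 : ℕ) : ℝ) * U - ∑ ζ, A ζ + A 0 := by
    rw [Finset.sum_sub_distrib, Finset.sum_const, Finset.card_erase_of_mem (Finset.mem_univ _),
      Finset.card_univ, nsmul_eq_mul, Finset.sum_erase_eq_sub (Finset.mem_univ _)]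
    ring
  rw [h1, ← h2]
  refine (norm_sum_le _ _).trans (Finset.sum_le_sum fun ζ hζ => ?_)
  have hU := hA ζ (Finset.ne_of_mem_erase hζ)
  rw [norm_mul, Complex.norm_real, Real.norm_of_nonpos (by linarith), neg_sub]
  exact mul_le_of_le_one_left (by linarith) (χ.norm_apply_le_one ζ)

theorem card_frobFixed {F L : Type*} [Field F] [Fintype F] [Field L] [Algebra F L]
    [IsAlgClosed L] {k : ℕ} (hk : k ≠ 0) :
    (frobFixed L (Fintype.card F) k).card = Fintype.card F ^ k := by
  classical
  obtain ⟨p, hp⟩ := CharP.exists F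
  obtain ⟨f, hprime, hf⟩ := FiniteField.card F p
  have : CharP L p := charP_of_injective_algebraMap (algebraMap F L).injective p
  have hsep : (X ^ Fintype.card F ^ k - X : L[X]).Separable := by
    refine galois_poly_separable p _ ?_
    rw [hf, ← pow_mul]
    exact dvd_pow_self _ (mul_ne_zero f.ne_zero hk)
  rw [frobFixed, Multiset.toFinset_card_of_nodup (nodup_roots hsep),
    splits_iff_card_roots.mp (IsAlgClosed.splits _),
    FiniteField.X_pow_card_pow_sub_X_natDegree_eq L hk Fintype.one_lt_card]

variable {F E : Type*} [Field F] [Fintype F] [Field E] [Fintype E] [Algebra F E]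

/-- The multiplicative function on polynomials over `F` given by evaluating at `β` and then
applying the character `χ`. -/
def charAeval (F : Type*) {E : Type*} [Field F] [Field E] [Algebra F E] (χ : MulChar E ℂ) (β : E) :
    F[X] →* ℂ :=
  χ.toMonoidHom.comp (aeval β : F[X] →ₐ[F] E).toMonoidHom

theorem charAeval_apply {F E : Type*} [Field F] [Field E] [Algebra F E]
    (χ : MulChar E ℂ) (β : E) (g : F[X]) :
    charAeval F χ β g = χ (aeval β g) := rfl

theorem natDegree_minpoly_eq {n : ℕ} (hE : Fintype.card E = Fintype.card F ^ n) (hn : n ≠ 0)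
    {β : E} (hsub : ∀ d : ℕ, d ∣ n → d < n → β ^ Fintype.card F ^ d ≠ β) :
    (minpoly F β).natDegree = n := by
  have hdvd : (minpoly F β).natDegree ∣ n :=
    pow_card_pow_eq_self_iff.mp (by rw [← hE, FiniteField.pow_card])
  by_contra hne
  exact hsub _ hdvd (lt_of_le_of_ne (Nat.le_of_dvd (Nat.pos_of_ne_zero hn) hdvd) hne)
    (pow_card_pow_eq_self_iff.mpr dvd_rfl)

theorem sum_monics_charAeval_eq_zero {χ : MulChar E ℂ} (hχ : χ ≠ 1) {β : E}
    (hβ : (minpoly F β).natDegree = Module.finrank F E) {m : ℕ} (hm : Module.finrank F E ≤ m) :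
    ∑ g ∈ monics F m, charAeval F χ β g = 0 := by
  have hintegral : IsIntegral F β := Algebra.IsIntegral.isIntegral β
  have hrep : ∀ e : E, ∃ h : F[X], h.degree < (m : WithBot ℕ) ∧ aeval β h = e := by
    intro e
    have htop := (Field.primitive_element_iff_minpoly_natDegree_eq F β).mpr hβ
    have he : e ∈ Algebra.adjoin F {β} := by
      rw [← IntermediateField.adjoin_simple_toSubalgebra_of_isAlgebraic hintegral.isAlgebraic, htop]
      trivial
    rw [Algebra.adjoin_singleton_eq_range_aeval] at he
    obtain ⟨u, rfl⟩ := he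
    refine ⟨u %ₘ minpoly F β, ?_, ?_⟩
    · refine (degree_modByMonic_lt u (minpoly.monic hintegral)).trans_le ?_
      rw [degree_eq_natDegree (minpoly.ne_zero hintegral), hβ]
      exact_mod_cast hm
    · exact (modByMonic_eq_sub_mul_div u (minpoly F β) ▸ by simp [minpoly.aeval])
  have hshift : ∀ e : E, ∑ g ∈ monics F m, χ (aeval β g + e) = ∑ g ∈ monics F m, χ (aeval β g) := by
    intro e
    obtain ⟨h, hdeg, rfl⟩ := hrep e
    have hmem : ∀ u : F[X], u.degree < (m : WithBot ℕ) → ∀ g ∈ monics F m, g + u ∈ monics F m := by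
      intro u hu g hg
      obtain ⟨hg1, hg2⟩ := mem_monics.mp hg
      have hlt : u.degree < g.degree := by
        rwa [degree_eq_natDegree hg1.ne_zero, hg2]
      refine mem_monics.mpr ⟨hg1.add_of_left hlt, ?_⟩
      rw [natDegree_add_eq_left_of_degree_lt hlt, hg2]
    refine Finset.sum_bij' (fun g _ => g + h) (fun g _ => g - h) (hmem h hdeg) ?_ ?_ ?_ ?_
    · intro g hg
      rw [sub_eq_add_neg]
      exact hmem (-h) (by rwa [degree_neg]) g hg
    · intro g _; simp
    · intro g _; simp
    · intro g _; simp
  have h1 : (Fintype.card E : ℂ) * ∑ g ∈ monics F m, χ (aeval β g) = 0 := by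
    calc (Fintype.card E : ℂ) * ∑ g ∈ monics F m, χ (aeval β g)
        = ∑ e : E, ∑ g ∈ monics F m, χ (aeval β g + e) := by
          rw [Finset.sum_congr rfl fun e _ => hshift e, Finset.sum_const, Finset.card_univ,
            nsmul_eq_mul]
      _ = ∑ g ∈ monics F m, ∑ e : E, χ (aeval β g + e) := Finset.sum_comm
      _ = 0 := by
          refine Finset.sum_eq_zero fun g _ => ?_
          rw [Fintype.sum_equiv (Equiv.addLeft (aeval β g)) (fun e => χ (aeval β g + e)) χ
            (fun e => rfl)]
          exact MulChar.sum_eq_zero_of_ne_one hχ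
  simp only [charAeval_apply]
  exact (mul_eq_zero.mp h1).resolve_left (by exact_mod_cast Fintype.card_ne_zero)

theorem sum_monics_zero (lam : F[X] →* ℂ) : ∑ g ∈ monics F 0, lam g = 1 := by
  have : monics F 0 = {1} := by
    ext g
    rw [mem_monics, Finset.mem_singleton]
    exact ⟨fun h => h.1.natDegree_eq_zero.mp h.2, by rintro rfl; simp⟩
  rw [this, Finset.sum_singleton, map_one]

theorem sum_monics_one {F E : Type*} [Field F] [Fintype F] [Field E] [Algebra F E]
    (χ : MulChar E ℂ) (β : E) :
    ∑ g ∈ monics F 1, charAeval F χ β g = ∑ a : F, χ (algebraMap F E a + β) := by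
  symm
  refine Finset.sum_bij (fun a _ => X + C a) ?_ ?_ ?_ ?_
  · intro a _
    exact mem_monics.mpr ⟨monic_X_add_C a, natDegree_X_add_C a⟩
  · intro a _ b _ h
    simpa using h
  · intro g hg
    obtain ⟨h1, h2⟩ := mem_monics.mp hg
    exact ⟨g.coeff 0, Finset.mem_univ _, (h1.eq_X_add_C h2).symm⟩
  · intro a _
    rw [charAeval_apply]
    simp [add_comm]

section AlgClosed

variable {L : Type*} [Field L] [Algebra F L]

theorem prod_range_sub_pow_card (b x : L) {n : ℕ} (hb : b ^ Fintype.card F ^ n = b) (t : ℕ) :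
    ∏ i ∈ Finset.range (n * t), (b - x ^ Fintype.card F ^ i) =
      (∏ i ∈ Finset.range n, (b - x ^ Fintype.card F ^ i)) ^
        ∑ l ∈ Finset.range t, (Fintype.card F ^ n) ^ l := by
  obtain ⟨p, hp⟩ := CharP.exists F
  obtain ⟨f, hprime, hf⟩ := FiniteField.card F p
  have : Fact p.Prime := ⟨hprime⟩
  have : CharP L p := charP_of_injective_algebraMap (algebraMap F L).injective p
  set q := Fintype.card F
  have hbl : ∀ l, b ^ (q ^ n) ^ l = b := by
    intro l
    induction l with
    | zero => simp
    | succ l ih => rw [pow_succ, pow_mul, ih, hb]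
  induction t with
  | zero => simp
  | succ t ih =>
    rw [mul_add, mul_one, Finset.prod_range_add, ih, Finset.sum_range_succ, pow_add]
    congr 1
    rw [← Finset.prod_pow]
    refine Finset.prod_congr rfl fun i _ => ?_
    have h1 : (q ^ n) ^ t = p ^ ((f : ℕ) * n * t) := by
      rw [hf, ← pow_mul, ← pow_mul, mul_assoc]
    conv_rhs => rw [h1, sub_pow_char_pow, ← h1, hbl, ← pow_mul]
    rw [pow_add, pow_mul q n t, mul_comm]

/-- The cofactor of `X` in the polynomial `∏ i < n, (b ^ q ^ (n - i) - b - X) ^ q ^ i`. -/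
def normCofactor (q n : ℕ) (b : L) : L[X] :=
  -∏ i ∈ Finset.Ico 1 n, (C (b ^ q ^ (n - i) - b) - X) ^ q ^ i

theorem eval_X_mul_normCofactor (b x : L) {n : ℕ} (hn : 0 < n)
    (hb : b ^ Fintype.card F ^ n = b) :
    (X * normCofactor (Fintype.card F) n b).eval (x - b) =
      ∏ i ∈ Finset.range n, (b - x ^ Fintype.card F ^ i) := by
  obtain ⟨p, hp⟩ := CharP.exists F
  obtain ⟨f, hprime, hf⟩ := FiniteField.card F p
  have : Fact p.Prime := ⟨hprime⟩
  have : CharP L p := charP_of_injective_algebraMap (algebraMap F L).injective p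
  set q := Fintype.card F
  rw [Finset.range_eq_Ico, Finset.prod_eq_prod_Ico_succ_bot hn, normCofactor]
  simp only [eval_mul, eval_X, eval_neg, eval_prod, eval_pow, eval_sub, eval_C, pow_zero, pow_one]
  rw [mul_neg, ← neg_mul, neg_sub]
  congr 1
  refine Finset.prod_congr rfl fun i hi => ?_
  have hi' := (Finset.mem_Ico.mp hi).2
  have h1 : q ^ i = p ^ ((f : ℕ) * i) := by rw [hf, ← pow_mul]
  rw [sub_sub, add_sub_cancel]
  conv_lhs => rw [h1, sub_pow_char_pow, ← h1, ← pow_mul, ← pow_add,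
    Nat.sub_add_cancel hi'.le, hb]

theorem eval_zero_normCofactor_ne_zero {L : Type*} [Field L] {q n : ℕ} {b : L}
    (hb : ∀ i, 0 < i → i < n → b ^ q ^ i ≠ b) : (normCofactor q n b).eval 0 ≠ 0 := by
  rw [normCofactor, eval_neg, neg_ne_zero, eval_prod, Finset.prod_ne_zero_iff]
  intro i hi
  obtain ⟨h1, h2⟩ := Finset.mem_Ico.mp hi
  simp only [eval_pow, eval_sub, eval_C, eval_X, sub_zero]
  exact pow_ne_zero _ (sub_ne_zero.mpr (hb _ (by omega) (by omega)))

end AlgClosed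

end CharacterSums

section FibreBounds

variable {F L : Type*} [Field F] [Fintype F] [Field L] [Algebra F L] [Algebra.IsAlgebraic F L]

theorem aeval_charPow_eq_eval_pow {n : ℕ} (hn : 0 < n) {b x : L}
    (hb : b ^ Fintype.card F ^ n = b) {t : ℕ} (hx : x ^ Fintype.card F ^ (n * t) = x) :
    aeval b (charPow F x (n * t)) =
      ((X * normCofactor (Fintype.card F) n b).eval (x - b)) ^
        ∑ l ∈ Finset.range t, (Fintype.card F ^ n) ^ l := by
  rw [aeval_charPow (pow_card_pow_eq_self_iff.mp hx), prod_range_sub_pow_card b x hb,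
    eval_X_mul_normCofactor b x hn hb]

theorem sum_range_two_mul_pow {Q s w r : ℕ} (hQ : 2 ≤ Q) (hr : r = Q ^ s)
    (hw : w = ∑ l ∈ Finset.range s, Q ^ l) :
    (Q - 1) * w + 1 = r ∧ ∑ l ∈ Finset.range (2 * s), Q ^ l = w * (r + 1) := by
  obtain ⟨d, rfl⟩ : ∃ d, Q = d + 1 := ⟨Q - 1, by omega⟩
  have h1 : w * d + 1 = r := by rw [hw, hr, geom_sum_mul_add]
  refine ⟨by rw [← h1, Nat.add_sub_cancel]; ring, ?_⟩
  rw [two_mul, Finset.sum_range_add]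
  simp only [pow_add, ← Finset.mul_sum]
  rw [← hw, ← hr]
  ring

open Classical in
theorem card_filter_aeval_charPow_eq_le [IsAlgClosed L] {n s : ℕ} (hn : 2 ≤ n) (hs : s ≠ 0)
    {b : L} (hb : b ^ Fintype.card F ^ n = b)
    (hbi : ∀ i, 0 < i → i < n → b ^ Fintype.card F ^ i ≠ b) {ζ : L} (hζ : ζ ≠ 0) :
    (Fintype.card F ^ n - 1) * ((frobFixed L (Fintype.card F) (n * (2 * s))).filter
        fun x => aeval b (charPow F x (n * (2 * s))) = ζ).card ≤
      (Fintype.card F ^ n) ^ s * (Fintype.card F ^ n) ^ s + (Fintype.card F ^ n - 1) *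
        (3 * (X * normCofactor (Fintype.card F) n b).natDegree + 2) *
          (Fintype.card F ^ n) ^ s := by
  classical
  obtain ⟨p, hp⟩ := CharP.exists F
  obtain ⟨f, hprime, hf⟩ := FiniteField.card F p
  have : Fact p.Prime := ⟨hprime⟩
  have : CharP L p := charP_of_injective_algebraMap (algebraMap F L).injective p
  have hq1 : 1 < Fintype.card F := Fintype.one_lt_card
  set q := Fintype.card F
  set r := (q ^ n) ^ s with hr
  have hQ4 : 4 ≤ q ^ n := by
    calc 4 = 2 ^ 2 := rfl
      _ ≤ q ^ 2 := Nat.pow_le_pow_left hq1 2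
      _ ≤ q ^ n := Nat.pow_le_pow_right (by omega) hn
  have hr4 : 4 ≤ r := hQ4.trans (Nat.le_self_pow hs _)
  obtain ⟨hdw, hsum⟩ := sum_range_two_mul_pow (by omega : 2 ≤ q ^ n) hr rfl
  have hrr : r * r = q ^ (n * (2 * s)) := by
    rw [hr, ← pow_add, ← pow_mul]; congr 1; ring
  have hbr : b ^ (r * r) = b := by
    have : ∀ l, b ^ (q ^ n) ^ l = b := by
      intro l
      induction l with
      | zero => simp
      | succ l ih => rw [pow_succ, pow_mul, ih, hb]
    rw [hrr, pow_mul, this]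
  set S := (frobFixed L q (n * (2 * s))).filter
    fun x => aeval b (charPow F x (n * (2 * s))) = ζ with hS
  have hcard : (S.image fun x => x - b).card = S.card :=
    Finset.card_image_of_injective _ (sub_left_injective)
  rw [← hcard]
  refine stepanov_bound p ((f : ℕ) * n * s) r (q ^ n - 1) _ _ ?_ hr4 (by omega) hdw
    (normCofactor q n b) (eval_zero_normCofactor_ne_zero hbi) le_rfl ζ hζ _ ?_
  · rw [hr, hf, ← pow_mul, ← pow_mul, mul_assoc]
  · intro y hy
    obtain ⟨x, hx, rfl⟩ := Finset.mem_image.mp hy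
    obtain ⟨hx1, hx2⟩ := Finset.mem_filter.mp hx
    rw [mem_frobFixed hq1 (by positivity)] at hx1
    constructor
    · have h1 : r * r = p ^ ((f : ℕ) * (n * (2 * s))) := by rw [hrr, hf, ← pow_mul]
      conv_lhs => rw [h1, sub_pow_char_pow, ← h1, hbr, hrr, hx1]
    · rw [aeval_charPow_eq_eval_pow (by omega) hb hx1, hsum] at hx2
      exact hx2

open Classical in
theorem card_filter_aeval_charPow_eq_zero_le {n t : ℕ} (hn : 0 < n) (ht : t ≠ 0)
    {b : L} (hb : b ^ Fintype.card F ^ n = b)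
    (hbi : ∀ i, 0 < i → i < n → b ^ Fintype.card F ^ i ≠ b) :
    ((frobFixed L (Fintype.card F) (n * t)).filter
        fun x => aeval b (charPow F x (n * t)) = 0).card ≤
      (X * normCofactor (Fintype.card F) n b).natDegree := by
  classical
  set q := Fintype.card F
  have hne : X * normCofactor q n b ≠ 0 := by
    refine mul_ne_zero X_ne_zero fun h => eval_zero_normCofactor_ne_zero hbi ?_
    rw [h, eval_zero]
  set S := (frobFixed L q (n * t)).filter
    fun x => aeval b (charPow F x (n * t)) = 0 with hS
  have hcard : (S.image fun x => x - b).card = S.card :=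
    Finset.card_image_of_injective _ (sub_left_injective)
  rw [← hcard]
  refine (Finset.card_le_card (t := (X * normCofactor q n b).roots.toFinset) ?_).trans
    ((Multiset.toFinset_card_le _).trans (card_roots' _))
  intro y hy
  obtain ⟨x, hx, rfl⟩ := Finset.mem_image.mp hy
  obtain ⟨hx1, hx2⟩ := Finset.mem_filter.mp hx
  rw [mem_frobFixed Fintype.one_lt_card (by positivity)] at hx1
  rw [aeval_charPow_eq_eval_pow hn hb hx1] at hx2
  rw [Multiset.mem_toFinset, mem_roots hne]
  exact eq_zero_of_pow_eq_zero hx2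

theorem norm_sum_frobFixed_charAeval_le {E : Type*} [Field E] [Fintype E] [Algebra F E]
    [Algebra E L] [IsScalarTower F E L] [IsAlgClosed L] {n s : ℕ} (hn : 2 ≤ n) (hs : s ≠ 0)
    (hE : Fintype.card E = Fintype.card F ^ n) {β : E}
    (hβ : ∀ i, 0 < i → i < n → β ^ Fintype.card F ^ i ≠ β) {χ : MulChar E ℂ} (hχ : χ ≠ 1) :
    ‖∑ x ∈ frobFixed L (Fintype.card F) (n * (2 * s)),
        charAeval F χ β (charPow F x (n * (2 * s)))‖ ≤
      (Fintype.card F ^ n * (3 * (X * normCofactor (Fintype.card F) n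
        (algebraMap E L β)).natDegree + 2) : ℝ) * ((Fintype.card F : ℝ) ^ n) ^ s := by
  classical
  have hq1 : 1 < Fintype.card F := Fintype.one_lt_card
  have hinj := (algebraMap E L).injective
  set b := algebraMap E L β with hbdef
  have hb : b ^ Fintype.card F ^ n = b := by
    rw [hbdef, ← map_pow, ← hE, FiniteField.pow_card]
  have hbi : ∀ i, 0 < i → i < n → b ^ Fintype.card F ^ i ≠ b := fun i h1 h2 h => by
    rw [hbdef, ← map_pow] at h
    exact hβ i h1 h2 (hinj h)
  set D := (X * normCofactor (Fintype.card F) n b).natDegree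
  set T := frobFixed L (Fintype.card F) (n * (2 * s)) with hT
  set A : E → Finset L := fun ζ =>
    T.filter fun x => aeval β (charPow F x (n * (2 * s))) = ζ with hA
  have hAL : ∀ ζ, A ζ = T.filter fun x =>
      aeval b (charPow F x (n * (2 * s))) = algebraMap E L ζ := by
    intro ζ
    refine Finset.filter_congr fun x _ => ?_
    rw [hbdef, aeval_algebraMap_apply, hinj.eq_iff]
  have hA0 : (A 0).card ≤ D := by
    rw [hAL, map_zero]
    exact card_filter_aeval_charPow_eq_zero_le (by omega) (by omega) hb hbi
  have hAζ : ∀ ζ, ζ ≠ 0 → (Fintype.card F ^ n - 1) * (A ζ).card ≤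
      (Fintype.card F ^ n) ^ s * (Fintype.card F ^ n) ^ s +
        (Fintype.card F ^ n - 1) * (3 * D + 2) * (Fintype.card F ^ n) ^ s := fun ζ hζ => by
    rw [hAL]
    exact card_filter_aeval_charPow_eq_le hn hs hb hbi ((map_ne_zero_iff _ hinj).mpr hζ)
  have hsum : ∑ x ∈ T, charAeval F χ β (charPow F x (n * (2 * s))) =
      ∑ ζ, χ ζ * (((A ζ).card : ℝ) : ℂ) := by
    rw [← Finset.sum_fiberwise T fun x => aeval β (charPow F x (n * (2 * s)))]
    refine Finset.sum_congr rfl fun ζ _ => ?_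
    rw [Finset.sum_congr rfl (g := fun _ => χ ζ) fun x hx => by
      rw [charAeval_apply, (Finset.mem_filter.mp hx).2], Finset.sum_const, nsmul_eq_mul, mul_comm,
      Complex.ofReal_natCast]
  have htot : ∑ ζ, ((A ζ).card : ℝ) = ((Fintype.card F : ℝ) ^ n) ^ s *
      ((Fintype.card F : ℝ) ^ n) ^ s := by
    have h := Finset.card_eq_sum_card_fiberwise (s := T) (t := Finset.univ)
      (f := fun x => aeval β (charPow F x (n * (2 * s)))) fun x _ => by simp
    rw [← Nat.cast_sum, ← h, hT, card_frobFixed (by positivity)]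
    push_cast
    rw [← pow_add, ← pow_mul]
    congr 1; ring
  set r : ℝ := ((Fintype.card F : ℝ) ^ n) ^ s with hr
  have hQ : 1 < Fintype.card F ^ n := Nat.one_lt_pow (by omega) hq1
  have hd : (0 : ℝ) < ((Fintype.card F ^ n - 1 : ℕ) : ℝ) := by exact_mod_cast Nat.sub_pos_of_lt hQ
  have hdQ : ((Fintype.card F ^ n - 1 : ℕ) : ℝ) = (Fintype.card F : ℝ) ^ n - 1 := by
    rw [Nat.cast_sub hQ.le]; push_cast; ring
  have hr1 : 1 ≤ r := one_le_pow₀ (one_le_pow₀ (by exact_mod_cast hq1.le))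
  have key := MulChar.norm_sum_mul_le hχ (fun ζ => ((A ζ).card : ℝ))
    ((r * r + ((Fintype.card F ^ n - 1 : ℕ) : ℝ) * (3 * D + 2) * r) /
      ((Fintype.card F ^ n - 1 : ℕ) : ℝ)) fun ζ hζ => by
        rw [le_div_iff₀ hd, mul_comm]
        have := hAζ ζ hζ
        rw [hr]
        exact_mod_cast this
  rw [hsum]
  refine key.trans ?_
  rw [htot, hE, mul_div_cancel₀ _ hd.ne', hdQ]
  have hA0' : ((A 0).card : ℝ) ≤ D := by exact_mod_cast hA0
  have hD : (0 : ℝ) ≤ D := by positivity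
  nlinarith [mul_nonneg hD (sub_nonneg.mpr hr1)]

end FibreBounds

theorem pow_card_pow_ne_self {F E : Type*} [Field F] [Fintype F] [Field E] [Fintype E]
    [Algebra F E] {n : ℕ} {β : E} (hβ : (minpoly F β).natDegree = n) {i : ℕ} (hi : 0 < i)
    (hin : i < n) : β ^ Fintype.card F ^ i ≠ β := by
  rw [Ne, pow_card_pow_eq_self_iff, hβ]
  exact Nat.not_dvd_of_pos_of_lt hi hin

/-- Katz's bound for the sum of a nontrivial multiplicative character over the translates by `F`
of a generator of `E` over `F`. -/
theorem norm_sum_mulChar_algebraMap_add_le {F E : Type*} [Field F] [Fintype F] [Field E]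
    [Fintype E] [Algebra F E] {n : ℕ} (hn : 2 ≤ n) (hE : Fintype.card E = Fintype.card F ^ n)
    {β : E} (hβ : (minpoly F β).natDegree = n) {χ : MulChar E ℂ} (hχ : χ ≠ 1) :
    ‖∑ a : F, χ (algebraMap F E a + β)‖ ≤ ((n : ℝ) - 1) * √(Fintype.card F : ℝ) := by
  classical
  have hq1 : 1 < Fintype.card F := Fintype.one_lt_card
  have hfr : Module.finrank F E = n := by
    have h := Module.card_eq_pow_finrank (K := F) (V := E)
    rw [hE] at h
    exact (Nat.pow_right_injective hq1 h).symm
  let L := AlgebraicClosure E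
  have : Algebra.IsAlgebraic F L := Algebra.IsAlgebraic.trans F E L
  set c : ℕ → ℂ := fun m => ∑ g ∈ monics F m, charAeval F χ β g with hc
  set S : ℕ → ℂ := fun k =>
    ∑ x ∈ frobFixed L (Fintype.card F) k, charAeval F χ β (charPow F x k) with hS
  have hc0 : c 0 = 1 := sum_monics_zero _
  have hrec : ∀ m : ℕ, (m : ℂ) * c m = ∑ k ∈ Finset.Icc 1 m, S k * c (m - k) := fun m =>
    newton_recurrence_monics F L (charAeval F χ β) m
  obtain ⟨ω, hω⟩ := exists_power_sum_of_newton_recurrence (n - 1) c S hc0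
    (fun m hm => sum_monics_charAeval_eq_zero hχ (hβ.trans hfr.symm) (by omega))
    fun m _ => hrec m
  have hq0 : (0 : ℝ) < Fintype.card F := by exact_mod_cast Fintype.card_pos
  have hQ0 : (0 : ℝ) < (Fintype.card F : ℝ) ^ n := by positivity
  have hωle : ∀ i, ‖ω i‖ ≤ √(Fintype.card F : ℝ) := by
    intro i
    have h := norm_le_one_of_bounded_power_sums
      (fun i => ω i ^ (2 * n) / (((Fintype.card F : ℝ) ^ n : ℝ) : ℂ)) _ (fun s hs => by
        have h1 : ∑ i, (ω i ^ (2 * n) / (((Fintype.card F : ℝ) ^ n : ℝ) : ℂ)) ^ s =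
            -S (n * (2 * s)) / ((((Fintype.card F : ℝ) ^ n) ^ s : ℝ) : ℂ) := by
          rw [hω _ (by nlinarith), neg_neg, Finset.sum_div]
          refine Finset.sum_congr rfl fun i _ => ?_
          rw [div_pow, ← pow_mul, Complex.ofReal_pow _ s]
          congr 2; ring
        rw [h1, norm_div, norm_neg, Complex.norm_real, Real.norm_of_nonneg (by positivity),
          div_le_iff₀ (by positivity)]
        exact norm_sum_frobFixed_charAeval_le hn (by omega) hE
          (fun i hi hin => pow_card_pow_ne_self hβ hi hin) hχ) i
    rw [norm_div, norm_pow, Complex.norm_real, Real.norm_of_nonneg hQ0.le, div_le_one hQ0] at h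
    refine (pow_le_pow_iff_left₀ (norm_nonneg _) (Real.sqrt_nonneg _)
      (by omega : 2 * n ≠ 0)).mp ?_
    rwa [pow_mul (√_), Real.sq_sqrt hq0.le]
  have h1 : ∑ a : F, χ (algebraMap F E a + β) = -∑ i, ω i := by
    have h := hrec 1
    simp only [Finset.Icc_self, Finset.sum_singleton, Nat.cast_one, one_mul, Nat.sub_self, hc0,
      mul_one, hω 1 le_rfl, pow_one] at h
    exact (sum_monics_one χ β).symm.trans h
  rw [h1, norm_neg]
  refine (norm_sum_le _ _).trans ((Finset.sum_le_card_nsmul _ _ _ fun i _ => hωle i).trans ?_)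
  rw [Finset.card_univ, Fintype.card_fin, nsmul_eq_mul, Nat.cast_sub (by omega), Nat.cast_one]

/-- Let `q` be a prime power, `n ≥ 4`, `m` a positive divisor of `q^n - 1`, and `β` a
`2`-normal element of `F_{q^n}` over `F_q` lying in no proper subfield `F_{q^d}`, `d ∣ n`,
`d < n`.  If `q^{1/2} ≥ (n-1)·W(m)` then the number `N_β(m)` of `a ∈ F_q` such that
`a + β` is `m`-free is positive; in particular such an `a` exists. -/
theorem Nbeta_pos (q n : ℕ) (hq : IsPrimePow q) (hn : 4 ≤ n)
    (F E : Type*) [Field F] [Fintype F] [Field E] [Fintype E] [Algebra F E]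
    (hF : Fintype.card F = q) (hE : Fintype.card E = q ^ n)
    (m : ℕ) (hm : 0 < m) (hmd : m ∣ q ^ n - 1)
    (β : E) (hβ : IsKNormal q n 2 β)
    (hsub : ∀ d : ℕ, d ∣ n → d < n → β ^ q ^ d ≠ β)
    (hbound : ((n : ℝ) - 1) * (Wnat m : ℝ) ≤ (q : ℝ) ^ ((1 : ℝ) / 2)) :
    0 < Nat.card {a : F // IsFree m (algebraMap F E a + β)} ∧
      ∃ a : F, IsFree m (algebraMap F E a + β) := by
  subst hF
  suffices h : ∃ a : F, IsFree m (algebraMap F E a + β) by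
    obtain ⟨a, ha⟩ := h
    have : Nonempty {a : F // IsFree m (algebraMap F E a + β)} := ⟨⟨a, ha⟩⟩
    exact ⟨Nat.card_pos, a, ha⟩
  have hdeg : (minpoly F β).natDegree = n := natDegree_minpoly_eq hE (by omega) hsub
  have hv : ∀ a : F, algebraMap F E a + β ≠ 0 := by
    intro a ha
    refine hsub 1 (one_dvd n) (by omega) ?_
    rw [eq_neg_of_add_eq_zero_right ha, ← map_neg, ← map_pow, pow_one, FiniteField.pow_card]
  have hψ : ∀ ℓ ∈ m.primeFactors, ∃ ψ : MulChar E ℂ, orderOf ψ = ℓ := by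
    intro ℓ hℓ
    have hpos := (Nat.prime_of_mem_primeFactors hℓ).pos
    refine MulChar.exists_mulChar_orderOf E ?_ (Complex.isPrimitiveRoot_exp ℓ hpos.ne')
    rw [hE]
    exact (Nat.dvd_of_mem_primeFactors hℓ).trans hmd
  choose! ψ hψ using hψ
  set B : ℝ := ((n : ℝ) - 1) * √(Fintype.card F : ℝ) with hB
  have hsieve := (MulChar.sieve_bound (fun a : F => algebraMap F E a + β) hv B
    (fun χ hχ => norm_sum_mulChar_algebraMap_add_le (by omega) hE hdeg hχ) ψ m.primeFactors
    (fun ℓ hℓ => Nat.prime_of_mem_primeFactors hℓ) hψ 1 (fun ℓ _ => by simp)).2 rfl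
  by_contra! hnone
  have hzero : ∀ a : F, ∏ ℓ ∈ m.primeFactors,
      (if ψ ℓ (algebraMap F E a + β) = 1 then (0 : ℂ) else 1) = 0 := by
    intro a
    have h1 := hnone a
    simp only [IsFree, not_and, not_forall] at h1
    obtain ⟨d, hdm, ⟨δ, hδ⟩, hd1⟩ := h1 (hv a)
    obtain ⟨ℓ, hℓ, hℓd⟩ := Nat.exists_prime_and_dvd hd1
    have hmem : ℓ ∈ m.primeFactors := Nat.mem_primeFactors.mpr ⟨hℓ, hℓd.trans hdm, hm.ne'⟩
    refine Finset.prod_eq_zero hmem (if_pos ?_)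
    obtain ⟨e, rfl⟩ := hℓd
    have hδ0 : IsUnit (δ ^ e) := by
      refine IsUnit.mk0 _ fun h => hv a ?_
      rw [hδ, mul_comm, pow_mul, h, zero_pow hℓ.ne_zero]
    rw [hδ, mul_comm, pow_mul, map_pow, ← MulChar.pow_apply' _ hℓ.ne_zero]
    nth_rewrite 2 [← hψ ℓ hmem]
    rw [pow_orderOf_eq_one, MulChar.one_apply hδ0]
  simp only [hzero, mul_zero, Finset.sum_const_zero, zero_sub, norm_neg] at hsieve
  have hθ : 0 < ∏ ℓ ∈ m.primeFactors, (1 - 1 / (ℓ : ℝ)) := by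
    refine Finset.prod_pos fun ℓ hℓ => ?_
    have : (1 : ℝ) < ℓ := by exact_mod_cast (Nat.prime_of_mem_primeFactors hℓ).one_lt
    rw [sub_pos, div_lt_one (by linarith)]
    exact this
  have hq0 : (0 : ℝ) < Fintype.card F := by exact_mod_cast Fintype.card_pos
  rw [Complex.norm_real, Real.norm_of_nonneg (by positivity), mul_assoc,
    mul_le_mul_iff_right₀ hθ] at hsieve
  have hW : (2 : ℝ) ^ m.primeFactors.card = Wnat m := by
    exact_mod_cast two_pow_card_primeFactors_eq_Wnat hm
  rw [hW] at hsieve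
  rw [← Real.sqrt_eq_rpow] at hbound
  have hs0 : 0 < √(Fintype.card F : ℝ) := Real.sqrt_pos.mpr hq0
  have hs2 : √(Fintype.card F : ℝ) * √(Fintype.card F : ℝ) = Fintype.card F :=
    Real.mul_self_sqrt hq0.le
  have hn' : (4 : ℝ) ≤ n := by exact_mod_cast hn
  have hBpos : 0 < B := mul_pos (by linarith) hs0
  have h2 := mul_le_mul_of_nonneg_right hbound hs0.le
  rw [hs2] at h2
  have h3 : ((n : ℝ) - 1) * Wnat m * √(Fintype.card F : ℝ) = Wnat m * B := by rw [hB]; ring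
  linarith

end
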